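/- arXiv:1611.04265 — 3 statements merged into one kernel-verified Lean document; each statement's English description precedes it below -/
import Mathlib

section
/- Let n be odd, let p : ZMod n → ℝ³ be a closed polygon, and let ξ ∈ ℝ³. Suppose there is a constant c such that |⟨p(i+1) − p(i), ξ⟩| = c for all i ∈ ZMod n (all edges have the same absolute slope with respect to the plane ξ^⊥). Then c = 0; that is, ⟨p(i), ξ⟩ is the same for all i, so the polygon is contained in an affine plane orthogonal to ξ. -/
open scoped RealInnerProductSpace

/-- Let `n` be odd, let `p : ZMod n → ℝ³` be a closed polygon, and let `ξ ∈ ℝ³`.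
If all edges have the same absolute slope `c` with respect to the plane `ξ^⊥`, i.e.
`|⟨p (i+1) - p i, ξ⟩| = c` for all `i`, then `c = 0`; hence `⟨p i, ξ⟩` is the same for
all `i`, so the polygon is contained in an affine plane orthogonal to `ξ`.
(The instance `NeZero n` is implied by `Odd n`; it is only needed to form `ZMod n` sums.) -/
theorem odd_polygon_equal_slopes_is_planar
    (n : ℕ) [NeZero n] (hn : Odd n)
    (p : ZMod n → EuclideanSpace ℝ (Fin 3)) (ξ : EuclideanSpace ℝ (Fin 3))
    (c : ℝ) (hslope : ∀ i : ZMod n, |⟪p (i + 1) - p i, ξ⟫| = c) :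
    c = 0 ∧ ∀ i j : ZMod n, ⟪p i, ξ⟫ = ⟪p j, ξ⟫ := by
  have key : ∀ k : ℕ, ∃ m : ℤ, ⟪p (k : ZMod n), ξ⟫ = ⟪p 0, ξ⟫ + m * c ∧ (m - k) % 2 = 0 := by
    intro k
    induction k with
    | zero => exact ⟨0, by simp⟩
    | succ k ih =>
      obtain ⟨m, hm, hp⟩ := ih
      have h := hslope (k : ZMod n)
      rw [inner_sub_left] at h
      rcases abs_choice (⟪p ((k : ZMod n) + 1), ξ⟫ - ⟪p (k : ZMod n), ξ⟫) with h1 | h1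
      · refine ⟨m + 1, ?_, by push_cast; omega⟩
        push_cast
        linarith
      · refine ⟨m - 1, ?_, by push_cast; omega⟩
        push_cast
        linarith
  have hc : c = 0 := by
    obtain ⟨m, hm, hp⟩ := key n
    rw [ZMod.natCast_self] at hm
    have h0 : (m : ℝ) * c = 0 := by linarith
    rcases mul_eq_zero.mp h0 with h | h
    · have : m = 0 := by exact_mod_cast h
      obtain ⟨t, ht⟩ := hn
      omega
    · exact h
  have h0 : ∀ i : ZMod n, ⟪p i, ξ⟫ = ⟪p 0, ξ⟫ := by
    intro i
    obtain ⟨m, hm, -⟩ := key i.val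
    rw [ZMod.natCast_zmod_val, hc, mul_zero, add_zero] at hm
    exact hm
  exact ⟨hc, fun i j => (h0 i).trans (h0 j).symm⟩
end

section
/- Let n = 2k+1 be odd, let ε : Fin n → ℝ with ε(i) ∈ {1, −1} for all i, let e := #{i : ε(i) = −1}, and let ω be an integer with 1 ≤ ω ≤ k − e. Set α := 2πω/(n − 2e), r := 1/(2 sin(α/2)), θ_j := α · ∑_{i < j} ε(i) for 0 ≤ j ≤ n, and p_j := (r cos θ_j, r sin θ_j) ∈ ℝ². Then: (i) 0 < α ≤ π, so r is well defined and r ≥ 1/2; (ii) ‖p_j‖ = r for all j; (iii) ‖p_{j+1} − p_j‖ = 1 for all 0 ≤ j ≤ n−1; and (iv) p_n = p_0, i.e. the polygon closes up (indeed θ_n = θ_0 + 2πω). Thus for every choice of a set of e ≤ k − ω clockwise edges and every winding number ω with 1 ≤ ω ≤ k − e there exists a closed equilateral unit-sided n-gon inscribed in the circle of radius r, whose i-th edge goes counterclockwise when ε(i) = 1 and clockwise when ε(i) = −1. -/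
open Classical in
/-- Existence of cyclic equilateral unit-sided `n`-gons, `n = 2k+1` odd, with a
prescribed set of clockwise edges and winding number.  Given a sign vector
`ε : Fin n → ℝ` with values `±1`, `e` the number of indices with `ε i = -1`, and a
winding number `ω` with `1 ≤ ω` and `ω + e ≤ k` (i.e. `1 ≤ ω ≤ k - e`), set
`α = 2πω/(n - 2e)`, `r = 1/(2 sin (α/2))`, `θ j = α ∑_{i < j} ε i`, and
`p j = (r cos θ j, r sin θ j)`.  Then `0 < α ≤ π` (so `r` is well defined and
`r ≥ 1/2`), all `p j` lie on the circle of radius `r`, consecutive vertices are at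
distance `1`, and the polygon closes up: `p n = p 0`, indeed `θ n = θ 0 + 2πω`. -/
theorem exists_cyclic_equilateral_polygon
    (k : ℕ) (n : ℕ) (hn : n = 2 * k + 1)
    (ε : Fin n → ℝ) (hε : ∀ i, ε i = 1 ∨ ε i = -1)
    (e : ℕ) (he : e = (Finset.univ.filter fun i => ε i = -1).card)
    (ω : ℕ) (hω1 : 1 ≤ ω) (hω2 : ω + e ≤ k)
    (α r : ℝ) (hα : α = 2 * Real.pi * ω / ((n : ℝ) - 2 * e))
    (hr : r = 1 / (2 * Real.sin (α / 2)))
    (θ : ℕ → ℝ)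
    (hθ : ∀ j : ℕ, θ j = α * ∑ i ∈ Finset.univ.filter (fun i : Fin n => (i : ℕ) < j), ε i)
    (p : ℕ → EuclideanSpace ℝ (Fin 2))
    (hp : ∀ j : ℕ, p j = ![r * Real.cos (θ j), r * Real.sin (θ j)]) :
    (0 < α ∧ α ≤ Real.pi ∧ 1 / 2 ≤ r) ∧
    (∀ j : ℕ, j ≤ n → ‖p j‖ = r) ∧
    (∀ j : ℕ, j < n → ‖p (j + 1) - p j‖ = 1) ∧
    p n = p 0 ∧ θ n = θ 0 + 2 * Real.pi * ω := by
  have hπ := Real.pi_pos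
  have hnR : (n : ℝ) = 2 * k + 1 := by rw [hn]; push_cast; ring
  have hωR : (1 : ℝ) ≤ ω := by exact_mod_cast hω1
  have hkR : (ω : ℝ) + e ≤ k := by exact_mod_cast hω2
  have hD : (0 : ℝ) < (n : ℝ) - 2 * e := by rw [hnR]; linarith
  have hα0 : 0 < α := by rw [hα]; positivity
  have hα1 : α ≤ Real.pi := by
    rw [hα, div_le_iff₀ hD, hnR]
    nlinarith
  have hs : 0 < Real.sin (α / 2) := Real.sin_pos_of_pos_of_lt_pi (by linarith) (by linarith)
  have hr0 : 0 < r := by rw [hr]; positivity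
  have hrs : r * (2 * Real.sin (α / 2)) = 1 := by rw [hr]; field_simp
  have hr1 : 1 / 2 ≤ r := by
    nlinarith [Real.sin_le_one (α / 2)]
  have hsum : ∑ i, ε i = (n : ℝ) - 2 * e := by
    have h1 : ∀ i, ε i = 1 - 2 * (if ε i = -1 then (1 : ℝ) else 0) := by
      intro i
      rcases hε i with h | h <;> rw [h] <;> norm_num
    rw [Finset.sum_congr rfl (fun i _ => h1 i), Finset.sum_sub_distrib, ← Finset.mul_sum,
      Finset.sum_boole, he]
    simp
  have hθ0 : θ 0 = 0 := by rw [hθ]; simp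
  have hθn : θ n = 2 * Real.pi * ω := by
    rw [hθ, Finset.filter_true_of_mem (fun i _ => i.2), hsum, hα]
    field_simp
  have hstep : ∀ j (hj : j < n), θ (j + 1) = θ j + α * ε ⟨j, hj⟩ := by
    intro j hj
    have : Finset.univ.filter (fun i : Fin n => (i : ℕ) < j + 1)
        = insert ⟨j, hj⟩ (Finset.univ.filter (fun i : Fin n => (i : ℕ) < j)) := by
      ext i
      simp [Fin.ext_iff]
      omega
    rw [hθ, hθ, this, Finset.sum_insert (by simp)]
    ring
  have hp0 : ∀ j, p j 0 = r * Real.cos (θ j) := fun j => by simp [hp j]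
  have hp1 : ∀ j, p j 1 = r * Real.sin (θ j) := fun j => by simp [hp j]
  refine ⟨⟨hα0, hα1, hr1⟩, ?_, ?_, ?_, by rw [hθn, hθ0]; ring⟩
  · intro j _
    rw [EuclideanSpace.norm_eq, Fin.sum_univ_two, hp0, hp1, Real.norm_eq_abs, Real.norm_eq_abs,
      sq_abs, sq_abs, Real.sqrt_eq_iff_mul_self_eq_of_pos hr0]
    linear_combination (-r ^ 2) * Real.sin_sq_add_cos_sq (θ j)
  · intro j hj
    have hc : Real.cos (θ (j + 1) - θ j) = 1 - 2 * Real.sin (α / 2) ^ 2 := by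
      have h2 : Real.cos α = 1 - 2 * Real.sin (α / 2) ^ 2 := by
        have := Real.cos_two_mul (α / 2)
        rw [mul_div_cancel₀ α two_ne_zero] at this
        linarith [Real.sin_sq_add_cos_sq (α / 2)]
      rw [hstep j hj, add_sub_cancel_left, ← h2]
      rcases hε ⟨j, hj⟩ with h | h <;> rw [h] <;> simp
    rw [Real.cos_sub] at hc
    rw [EuclideanSpace.norm_eq, Fin.sum_univ_two, PiLp.sub_apply, PiLp.sub_apply, hp0, hp1, hp0,
      hp1, Real.norm_eq_abs, Real.norm_eq_abs, sq_abs, sq_abs, Real.sqrt_eq_one]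
    linear_combination r ^ 2 * Real.sin_sq_add_cos_sq (θ j)
      + r ^ 2 * Real.sin_sq_add_cos_sq (θ (j + 1)) - 2 * r ^ 2 * hc
      + (r * (2 * Real.sin (α / 2)) + 1) * hrs
  · have hc : Real.cos (θ n) = 1 := by
      rw [hθn, mul_comm]; exact Real.cos_nat_mul_two_pi ω
    have hs' : Real.sin (θ n) = 0 := by
      rw [hθn, show 2 * Real.pi * (ω : ℝ) = ((2 * ω : ℕ) : ℝ) * Real.pi by push_cast; ring]
      exact Real.sin_nat_mul_pi _
    ext i
    fin_cases i
    · change p n 0 = p 0 0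
      rw [hp0, hp0, hc, hθ0, Real.cos_zero]
    · change p n 1 = p 0 1
      rw [hp1, hp1, hs', hθ0, Real.sin_zero]
end

section
/- Let n = 2k+1 be odd, let ε : Fin n → ℝ with ε(i) ∈ {1, −1}, let e := #{i : ε(i) = −1}, let ω be an integer with 1 ≤ ω ≤ k − e, and define α := 2πω/(n − 2e), r := 1/(2 sin(α/2)), θ_j := α · ∑_{i < j} ε(i), and p_j := (r cos θ_j, r sin θ_j) for j ∈ ZMod n. Then the signed area of the resulting closed cyclic equilateral polygon equals A(p) = ½ r² (n − 2e) sin α; that is, ∑_{j ∈ ZMod n} (x_j y_{j+1} − x_{j+1} y_j) = r² (n − 2e) sin α, where p_j = (x_j, y_j). In particular the signed area is positive when ω ≥ 1. -/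
theorem aux_sum_zmod (n : ℕ) [NeZero n] (g : ℕ → ℝ) :
    ∑ j : ZMod n, g j.val = ∑ i : Fin n, g (i : ℕ) := by
  cases n with
  | zero => exact absurd rfl (NeZero.ne 0)
  | succ m => rfl

open Classical in
/-- The signed area of the cyclic equilateral `n`-gon (`n = 2k+1` odd) determined by a
sign vector `ε : Fin n → ℝ` with values `±1` (recording counterclockwise/clockwise
edges), with `e` clockwise edges and winding number `ω`, `1 ≤ ω ≤ k - e`: with
`α = 2πω/(n - 2e)`, `r = 1/(2 sin (α/2))`, `θ j = α ∑_{i < j} ε i`, and vertices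
`p j = (r cos θ_j, r sin θ_j)` for `j ∈ ZMod n`, one has
`∑ j, (x_j y_{j+1} - x_{j+1} y_j) = r² (n - 2e) sin α`, i.e.
`A(p) = ½ r² (n - 2e) sin α`; in particular the signed area is positive. -/
theorem signed_area_of_cyclic_equilateral_polygon
    (k : ℕ) (n : ℕ) [NeZero n] (hn : n = 2 * k + 1)
    (ε : Fin n → ℝ) (hε : ∀ i, ε i = 1 ∨ ε i = -1)
    (e : ℕ) (he : e = (Finset.univ.filter fun i => ε i = -1).card)
    (ω : ℕ) (hω1 : 1 ≤ ω) (hω2 : ω + e ≤ k)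
    (α r : ℝ) (hα : α = 2 * Real.pi * ω / ((n : ℝ) - 2 * e))
    (hr : r = 1 / (2 * Real.sin (α / 2)))
    (θ : ℕ → ℝ)
    (hθ : ∀ j : ℕ, θ j = α * ∑ i ∈ Finset.univ.filter (fun i : Fin n => (i : ℕ) < j), ε i)
    (p : ZMod n → EuclideanSpace ℝ (Fin 2))
    (hp : ∀ j : ZMod n, p j = ![r * Real.cos (θ j.val), r * Real.sin (θ j.val)]) :
    (∑ j : ZMod n, (p j 0 * p (j + 1) 1 - p (j + 1) 0 * p j 1)) =
      r ^ 2 * ((n : ℝ) - 2 * e) * Real.sin α ∧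
    0 < (∑ j : ZMod n, (p j 0 * p (j + 1) 1 - p (j + 1) 0 * p j 1)) := by
  have hpe : (e : ℝ) + ω ≤ k := by exact_mod_cast (by omega : e + ω ≤ k)
  have hω : (1 : ℝ) ≤ ω := by exact_mod_cast hω1
  have hnR : (n : ℝ) = 2 * k + 1 := by rw [hn]; push_cast; ring
  have hpos : 0 < (n : ℝ) - 2 * e := by linarith
  have hαm : α * ((n : ℝ) - 2 * e) = ω * (2 * Real.pi) := by
    rw [hα]; field_simp
  have hpi := Real.pi_pos
  have hα0 : 0 < α := by rw [hα]; positivity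
  have hα1 : α < Real.pi := by
    rw [hα, div_lt_iff₀ hpos]; nlinarith
  have hsum : ∑ i, ε i = (n : ℝ) - 2 * e := by
    have h1 : ∀ i, ε i = 1 - 2 * (if ε i = -1 then (1 : ℝ) else 0) := by
      intro i
      rcases hε i with h | h <;> rw [h] <;> norm_num
    rw [Finset.sum_congr rfl (fun i _ => h1 i), Finset.sum_sub_distrib, ← Finset.mul_sum,
      Finset.sum_boole, ← he]
    simp
  have hθ0 : θ 0 = 0 := by rw [hθ]; simp
  have hθn : θ n = ω * (2 * Real.pi) := by
    rw [hθ, Finset.filter_true_of_mem (fun i _ => i.2), hsum, hαm]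
  have hstep : ∀ i : Fin n, θ ((i : ℕ) + 1) = θ i + α * ε i := by
    intro i
    have : (Finset.univ.filter (fun l : Fin n => (l : ℕ) < (i : ℕ) + 1))
        = insert i (Finset.univ.filter (fun l : Fin n => (l : ℕ) < (i : ℕ))) := by
      ext l
      simp only [Finset.mem_filter, Finset.mem_univ, true_and, Finset.mem_insert, Fin.ext_iff]
      omega
    rw [hθ, hθ, this, Finset.sum_insert (by simp)]
    ring
  have hval : ∀ j : ZMod n, Real.cos (θ (j + 1).val) = Real.cos (θ (j.val + 1)) ∧
      Real.sin (θ (j + 1).val) = Real.sin (θ (j.val + 1)) := by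
    intro j
    have hj := ZMod.val_lt j
    have hv : (j + 1).val = (j.val + 1) % n := by
      rw [ZMod.val_add, ZMod.val_one_eq_one_mod, Nat.add_mod_mod]
    rw [hv]
    rcases Nat.lt_or_ge (j.val + 1) n with h | h
    · rw [Nat.mod_eq_of_lt h]; exact ⟨rfl, rfl⟩
    · have : j.val + 1 = n := by omega
      rw [this, Nat.mod_self, hθ0, hθn, Real.cos_nat_mul_two_pi, Real.cos_zero, Real.sin_zero]
      refine ⟨rfl, ?_⟩
      have := Real.sin_nat_mul_pi (2 * ω)
      push_cast at this
      rw [← this]; congr 1; ring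
  have hp0 : ∀ j, p j 0 = r * Real.cos (θ j.val) := fun j => by
    have := congrFun (hp j) 0
    simpa using this
  have hp1 : ∀ j, p j 1 = r * Real.sin (θ j.val) := fun j => by
    have := congrFun (hp j) 1
    simpa using this
  have key : (∑ j : ZMod n, (p j 0 * p (j + 1) 1 - p (j + 1) 0 * p j 1)) =
      r ^ 2 * ((n : ℝ) - 2 * e) * Real.sin α := by
    have h1 : ∀ j : ZMod n, (p j 0 * p (j + 1) 1 - p (j + 1) 0 * p j 1)
        = (fun m : ℕ => r ^ 2 * Real.sin (θ (m + 1) - θ m)) j.val := by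
      intro j
      simp only [hp0, hp1, (hval j).1, (hval j).2, Real.sin_sub]
      ring
    rw [Finset.sum_congr rfl (fun j _ => h1 j),
      aux_sum_zmod n (fun m : ℕ => r ^ 2 * Real.sin (θ (m + 1) - θ m))]
    have h2 : ∀ i : Fin n, (fun m : ℕ => r ^ 2 * Real.sin (θ (m + 1) - θ m)) (i : ℕ)
        = r ^ 2 * Real.sin α * ε i := by
      intro i
      simp only [hstep i, add_sub_cancel_left]
      rcases hε i with h | h <;> rw [h] <;> simp
    rw [Finset.sum_congr rfl (fun i _ => h2 i), ← Finset.mul_sum, hsum]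
    ring
  refine ⟨key, ?_⟩
  rw [key]
  have hs : 0 < Real.sin α := Real.sin_pos_of_pos_of_lt_pi hα0 hα1
  have hs2 : 0 < Real.sin (α / 2) :=
    Real.sin_pos_of_pos_of_lt_pi (by linarith) (by linarith)
  have hr0 : 0 < r := by rw [hr]; positivity
  positivity
end
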